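/- For every h ∈ ℝ, Owen's T function satisfies T(h, g) → (1 − Φ(|h|))/2 as g → +∞. -/

import Mathlib

open Real MeasureTheory Filter Topology

/-- Standard normal density. -/
noncomputable def stdNormalPdf (x : ℝ) : ℝ := Real.exp (-x ^ 2 / 2) / Real.sqrt (2 * Real.pi)

/-- Standard normal cumulative distribution function. -/
noncomputable def stdNormalCdf (x : ℝ) : ℝ := ∫ t in Set.Iic x, stdNormalPdf t

/-- Owen's T function. -/
noncomputable def owenT (h g : ℝ) : ℝ :=
  (1 / (2 * Real.pi)) * ∫ t in (0:ℝ)..g, Real.exp (-h ^ 2 * (1 + t ^ 2) / 2) / (1 + t ^ 2)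


theorem integrable_stdNormalPdf : Integrable stdNormalPdf := by
  unfold stdNormalPdf
  have := (integrable_exp_neg_mul_sq (b := 1 / 2) (by norm_num)).div_const (√(2 * π))
  refine this.congr (.of_forall fun x => ?_)
  simp only
  ring_nf

theorem integral_stdNormalPdf : ∫ x, stdNormalPdf x = 1 := by
  have h := integral_gaussian (1 / 2)
  have he : ∀ x : ℝ, stdNormalPdf x = exp (-(1 / 2) * x ^ 2) / √(2 * π) := fun x => by
    unfold stdNormalPdf
    ring_nf
  simp_rw [he]
  rw [integral_div, h, show π / (1 / 2) = 2 * π by ring]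
  exact div_self (by positivity)

theorem integral_Ioi_stdNormalPdf (x : ℝ) :
    ∫ t in Set.Ioi x, stdNormalPdf t = 1 - stdNormalCdf x := by
  have h := intervalIntegral.integral_Iic_add_Ioi (b := x)
    integrable_stdNormalPdf.integrableOn integrable_stdNormalPdf.integrableOn
  rw [integral_stdNormalPdf] at h
  unfold stdNormalCdf
  linarith

/-- The `x`-integral of `x * exp (-x² (1 + t²) / 2)` over `(h, ∞)` is Owen's integrand. -/
theorem integral_Ioi_mul_exp_neg_sq (h t : ℝ) (hh : 0 ≤ h) :
    ∫ x in Set.Ioi h, x * exp (-x ^ 2 * (1 + t ^ 2) / 2) =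
      exp (-h ^ 2 * (1 + t ^ 2) / 2) / (1 + t ^ 2) := by
  have ht : 0 < 1 + t ^ 2 := by positivity
  have hd : ∀ x ∈ Set.Ici h, HasDerivAt (fun x : ℝ => -exp (-x ^ 2 * (1 + t ^ 2) / 2) / (1 + t ^ 2))
      (x * exp (-x ^ 2 * (1 + t ^ 2) / 2)) x := fun x _ => by
    have h1 : HasDerivAt (fun x : ℝ => -x ^ 2 * (1 + t ^ 2) / 2) (-(2 * x) * (1 + t ^ 2) / 2) x := by
      simpa using (((hasDerivAt_pow 2 x).neg).mul_const (1 + t ^ 2)).div_const 2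
    refine (h1.exp.neg.div_const (1 + t ^ 2)).congr_deriv ?_
    field_simp
  have hlim : Tendsto (fun x : ℝ => -exp (-x ^ 2 * (1 + t ^ 2) / 2) / (1 + t ^ 2)) atTop (𝓝 0) := by
    have h2 : Tendsto (fun x : ℝ => -x ^ 2 * (1 + t ^ 2) / 2) atTop atBot := by
      have h3 := (tendsto_pow_atTop (α := ℝ) two_ne_zero).const_mul_atTop_of_neg
        (show -((1 + t ^ 2) / 2) < 0 by linarith)
      refine h3.congr fun x => by ring
    simpa using ((tendsto_exp_atBot.comp h2).neg).div_const (1 + t ^ 2)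
  rw [integral_Ioi_of_hasDerivAt_of_nonneg' hd
    (fun x hx => mul_nonneg (hh.trans hx.out.le) (exp_pos _).le) hlim]
  ring

/-- The `t`-integral of `x * exp (-x² (1 + t²) / 2)` over `(0, ∞)` is a multiple of the
normal density. -/
theorem integral_Ioi_zero_mul_exp_neg_sq (x : ℝ) (hx : 0 < x) :
    ∫ t in Set.Ioi (0 : ℝ), x * exp (-x ^ 2 * (1 + t ^ 2) / 2) = π * stdNormalPdf x := by
  have he : ∀ t : ℝ, x * exp (-x ^ 2 * (1 + t ^ 2) / 2) =
      x * exp (-x ^ 2 / 2) * exp (-(x ^ 2 / 2) * t ^ 2) := fun t => by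
    rw [mul_assoc, ← exp_add]
    ring_nf
  simp_rw [he]
  rw [integral_const_mul, integral_gaussian_Ioi, stdNormalPdf,
    show π / (x ^ 2 / 2) = 2 * π / x ^ 2 by field_simp, sqrt_div (by positivity), sqrt_sq hx.le]
  have hs : √(2 * π) ^ 2 = 2 * π := sq_sqrt (by positivity)
  have : 0 < √(2 * π) := by positivity
  field_simp
  rw [hs]

theorem integrable_mul_exp_neg_sq_prod (h : ℝ) (hh : 0 ≤ h) :
    Integrable (Function.uncurry fun x t : ℝ => x * exp (-x ^ 2 * (1 + t ^ 2) / 2))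
      ((volume.restrict (Set.Ioi h)).prod (volume.restrict (Set.Ioi 0))) := by
  rw [integrable_prod_iff (by
    apply Continuous.aestronglyMeasurable
    unfold Function.uncurry
    fun_prop)]
  constructor
  · filter_upwards [ae_restrict_mem measurableSet_Ioi] with x hx
    have hx0 : 0 < x := hh.trans_lt hx
    refine Integrable.of_integral_ne_zero ?_
    simp only [Function.uncurry_apply_pair]
    rw [integral_Ioi_zero_mul_exp_neg_sq x hx0]
    unfold stdNormalPdf
    positivity
  · refine (integrable_stdNormalPdf.integrableOn.const_mul π).congr ?_
    filter_upwards [ae_restrict_mem measurableSet_Ioi] with x hx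
    have hx0 : 0 < x := hh.trans_lt hx
    rw [← integral_Ioi_zero_mul_exp_neg_sq x hx0]
    refine integral_congr_ae (.of_forall fun t => ?_)
    simp only [Function.uncurry_apply_pair]
    rw [norm_of_nonneg (by positivity)]

theorem integral_Ioi_owen (h : ℝ) (hh : 0 ≤ h) :
    ∫ t in Set.Ioi (0 : ℝ), exp (-h ^ 2 * (1 + t ^ 2) / 2) / (1 + t ^ 2) =
      π * (1 - stdNormalCdf h) := by
  simp_rw [← integral_Ioi_mul_exp_neg_sq h _ hh]
  rw [← integral_integral_swap (integrable_mul_exp_neg_sq_prod h hh),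
    ← integral_Ioi_stdNormalPdf, ← integral_const_mul]
  exact setIntegral_congr_fun measurableSet_Ioi fun x hx =>
    integral_Ioi_zero_mul_exp_neg_sq x (hh.trans_lt hx)

theorem integrable_owen (h : ℝ) :
    Integrable fun t : ℝ => exp (-h ^ 2 * (1 + t ^ 2) / 2) / (1 + t ^ 2) := by
  refine integrable_inv_one_add_sq.mono' (Continuous.aestronglyMeasurable ?_)
    (.of_forall fun t => ?_)
  · exact Continuous.div (by fun_prop) (by fun_prop) fun t => by positivity
  · rw [norm_of_nonneg (by positivity), ← one_div]
    gcongr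
    exact exp_le_one_iff.2 (by nlinarith [mul_nonneg (sq_nonneg h) (sq_nonneg t), sq_nonneg h])

theorem stmt17 (h : ℝ) :
    Tendsto (fun g : ℝ => owenT h g) atTop (𝓝 ((1 - stdNormalCdf |h|) / 2)) := by
  unfold owenT
  have hlim := (intervalIntegral_tendsto_integral_Ioi 0 (integrable_owen h).integrableOn
    tendsto_id).const_mul (1 / (2 * π))
  have hI := integral_Ioi_owen |h| (abs_nonneg h)
  rw [sq_abs] at hI
  rw [hI] at hlim
  rwa [show 1 / (2 * π) * (π * (1 - stdNormalCdf |h|)) = (1 - stdNormalCdf |h|) / 2 by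
    field_simp] at hlim
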